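/- There exists a smooth function f : [0,∞) → (0,∞) ∪ {f(0)=0} with f(r) = sin r near 0, f(r) = √r for r ≥ 2, f concave on (π/4, 2), f'(0)=1 and all even derivatives of f vanishing at 0, such that −f''/f > 0 everywhere on (0,∞). -/

import Mathlib

open Real

namespace Interp

open Set Filter Topology

noncomputable def st : ℝ → ℝ := Real.smoothTransition

lemma st_smooth : ContDiff ℝ (⊤ : ℕ∞) st := Real.smoothTransition.contDiff
lemma st_cont : Continuous st := st_smooth.continuous
lemma st_nonneg (x : ℝ) : 0 ≤ st x := Real.smoothTransition.nonneg x
lemma st_le_one (x : ℝ) : st x ≤ 1 := Real.smoothTransition.le_one x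
lemma st_zero {x : ℝ} (h : x ≤ 0) : st x = 0 := Real.smoothTransition.zero_of_nonpos h
lemma st_one {x : ℝ} (h : 1 ≤ x) : st x = 1 := Real.smoothTransition.one_of_one_le h
lemma st_mono : Monotone st := Real.smoothTransition.monotone
lemma st_symm (x : ℝ) : st x + st (1 - x) = 1 := by
  have h := Real.smoothTransition.pos_denom x
  have h' := Real.smoothTransition.pos_denom (1 - x)
  simp only [st, Real.smoothTransition] at *
  rw [sub_sub_cancel] at *
  rw [add_comm (expNegInvGlue (1 - x)), ← add_div, div_self h.ne']
lemma st_hasDeriv (x : ℝ) : HasDerivAt st (deriv st x) x :=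
  ((st_smooth.differentiable (by simp)) x).hasDerivAt
lemma st_deriv_nonneg (x : ℝ) : 0 ≤ deriv st x := st_mono.deriv_nonneg

noncomputable def S (x : ℝ) : ℝ := ∫ t in (0:ℝ)..x, st t

lemma S_hasDeriv (x : ℝ) : HasDerivAt S (st x) x :=
  intervalIntegral.integral_hasDerivAt_right (st_cont.intervalIntegrable _ _)
    (st_cont.stronglyMeasurableAtFilter _ _) st_cont.continuousAt

lemma smooth_of_deriv {F g : ℝ → ℝ} (h : ∀ x, HasDerivAt F (g x) x)
    (hg : ContDiff ℝ (⊤ : ℕ∞) g) : ContDiff ℝ (⊤ : ℕ∞) F := by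
  rw [contDiff_infty_iff_deriv]
  refine ⟨fun x => (h x).differentiableAt, ?_⟩
  have : deriv F = g := funext fun x => (h x).deriv
  rwa [this]

lemma S_smooth : ContDiff ℝ (⊤ : ℕ∞) S := smooth_of_deriv S_hasDeriv st_smooth

lemma S_zero {x : ℝ} (h : x ≤ 0) : S x = 0 := by
  unfold S
  rw [intervalIntegral.integral_congr (g := fun _ => (0:ℝ))]
  · simp
  · intro t ht
    rw [uIcc_of_ge h] at ht
    exact st_zero ht.2

lemma S_one_val : S 1 = 1 / 2 := by
  have h1 : ∫ t in (0:ℝ)..1, st (1 - t) = S 1 := by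
    rw [intervalIntegral.integral_comp_sub_left (fun t => st t) 1]
    simp [S]
  have h2 : (∫ t in (0:ℝ)..1, (st t + st (1 - t))) = 1 := by
    simp [st_symm]
  rw [intervalIntegral.integral_add (st_cont.intervalIntegrable _ _)
    ((show Continuous fun t => st (1 - t) from
      st_cont.comp (by fun_prop)).intervalIntegrable _ _), h1] at h2
  unfold S at *
  linarith

lemma S_ge_one {x : ℝ} (h : 1 ≤ x) : S x = x - 1 / 2 := by
  have h1 : S 1 + (∫ t in (1:ℝ)..x, st t) = S x :=
    intervalIntegral.integral_add_adjacent_intervals (st_cont.intervalIntegrable _ _)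
      (st_cont.intervalIntegrable _ _)
  have h2 : (∫ t in (1:ℝ)..x, st t) = x - 1 := by
    rw [intervalIntegral.integral_congr (g := fun _ => (1:ℝ))]
    · simp
    · intro t ht
      rw [uIcc_of_le h] at ht
      exact st_one ht.1
  rw [← h1, h2, S_one_val]; ring

lemma S_mono : Monotone S :=
  monotone_of_deriv_nonneg (fun x => (S_hasDeriv x).differentiableAt)
    (fun x => by rw [(S_hasDeriv x).deriv]; exact st_nonneg x)

lemma S_nonneg (x : ℝ) : 0 ≤ S x := by
  rcases le_total x 0 with h | h
  · rw [S_zero h]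
  · rw [← S_zero le_rfl]; exact S_mono h

lemma S_le {x : ℝ} (h : 0 ≤ x) : S x ≤ x := by
  have hm : Monotone (fun y => y - S y) :=
    monotone_of_deriv_nonneg
      (fun x => ((hasDerivAt_id x).sub (S_hasDeriv x)).differentiableAt)
      (fun x => by
        have := ((hasDerivAt_id x).sub (S_hasDeriv x)).deriv
        have h2 : deriv (fun y => y - S y) x = 1 - st x := this
        rw [h2]; linarith [st_le_one x])
  have := hm h
  simp only [S_zero le_rfl] at this
  linarith

lemma S_cont : Continuous S := S_smooth.continuous

noncomputable def T (x : ℝ) : ℝ := ∫ t in (0:ℝ)..x, S t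

lemma T_hasDeriv (x : ℝ) : HasDerivAt T (S x) x :=
  intervalIntegral.integral_hasDerivAt_right (S_cont.intervalIntegrable _ _)
    (S_cont.stronglyMeasurableAtFilter _ _) S_cont.continuousAt

lemma T_smooth : ContDiff ℝ (⊤ : ℕ∞) T := smooth_of_deriv T_hasDeriv S_smooth

lemma T_zero {x : ℝ} (h : x ≤ 0) : T x = 0 := by
  unfold T
  rw [intervalIntegral.integral_congr (g := fun _ => (0:ℝ))]
  · simp
  · intro t ht
    rw [uIcc_of_ge h] at ht
    exact S_zero ht.2

lemma T_mono : Monotone T :=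
  monotone_of_deriv_nonneg (fun x => (T_hasDeriv x).differentiableAt)
    (fun x => by rw [(T_hasDeriv x).deriv]; exact S_nonneg x)

lemma T_nonneg (x : ℝ) : 0 ≤ T x := by
  rcases le_total x 0 with h | h
  · rw [T_zero h]
  · rw [← T_zero le_rfl]; exact T_mono h

lemma T_ge {x : ℝ} (h : 1 ≤ x) : (x - 1) ^ 2 / 2 ≤ T x := by
  have h1 : T 1 + (∫ t in (1:ℝ)..x, S t) = T x :=
    intervalIntegral.integral_add_adjacent_intervals (S_cont.intervalIntegrable _ _)
      (S_cont.intervalIntegrable _ _)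
  have h2 : (∫ t in (1:ℝ)..x, (t - 1)) ≤ ∫ t in (1:ℝ)..x, S t := by
    apply intervalIntegral.integral_mono_on h
    · exact (by fun_prop : Continuous fun t : ℝ => t - 1).intervalIntegrable _ _
    · exact S_cont.intervalIntegrable _ _
    · intro t ht
      rw [S_ge_one ht.1]; linarith
  have h3 : (∫ t in (1:ℝ)..x, (t - 1)) = (x - 1) ^ 2 / 2 := by
    rw [intervalIntegral.integral_sub (by simp) (by simp), integral_id]
    simp; ring
  linarith [T_nonneg 1]

/-- concave extension of `sin` past `π/4` -/
noncomputable def U (x : ℝ) : ℝ := sin x + 705 / 10000000 * T (100 * (x - π / 4))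
noncomputable def dU (x : ℝ) : ℝ := cos x + 705 / 100000 * S (100 * (x - π / 4))
noncomputable def ddU (x : ℝ) : ℝ := - sin x + 705 / 1000 * st (100 * (x - π / 4))

lemma lin_deriv (x : ℝ) : HasDerivAt (fun x : ℝ => 100 * (x - π / 4)) 100 x := by
  simpa using ((hasDerivAt_id x).sub_const (π / 4)).const_mul 100

lemma U_deriv (x : ℝ) : HasDerivAt U (dU x) x := by
  have := (hasDerivAt_sin x).add
    (((T_hasDeriv (100 * (x - π / 4))).comp x (lin_deriv x)).const_mul (705 / 10000000))
  refine this.congr_deriv ?_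
  unfold dU; ring
lemma dU_deriv (x : ℝ) : HasDerivAt dU (ddU x) x := by
  have := (hasDerivAt_cos x).add
    (((S_hasDeriv (100 * (x - π / 4))).comp x (lin_deriv x)).const_mul (705 / 100000))
  refine this.congr_deriv ?_
  unfold ddU; ring

lemma U_smooth : ContDiff ℝ (⊤ : ℕ∞) U := by
  have h : ContDiff ℝ (⊤ : ℕ∞) (fun x => T (100 * (x - π / 4))) := T_smooth.comp (by fun_prop)
  unfold U
  exact contDiff_sin.add (contDiff_const.mul h)

lemma U_eq {x : ℝ} (h : x ≤ π / 4) : U x = sin x := by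
  unfold U; rw [T_zero (by linarith)]; simp

lemma sin_ge {x : ℝ} (h : π / 4 ≤ x) (h2 : x ≤ 2) : 707 / 1000 < sin x := by
  have hp := Real.pi_gt_d4
  have h4 : (707 / 1000 : ℝ) < sin (π / 4) := by
    rw [sin_pi_div_four]
    have : (1.414 : ℝ) < √2 := Real.lt_sqrt_of_sq_lt (by norm_num)
    linarith
  rcases le_total x (π / 2) with h3 | h3
  · exact h4.trans_le (sin_le_sin_of_le_of_le_pi_div_two (by linarith) h3 h)
  · rw [← sin_pi_sub x]
    exact h4.trans_le (sin_le_sin_of_le_of_le_pi_div_two (by linarith) (by linarith) (by linarith))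

lemma ddU_neg {x : ℝ} (h : 0 < x) (h2 : x ≤ 2) : ddU x < 0 := by
  unfold ddU
  rcases le_total x (π / 4) with h3 | h3
  · rw [st_zero (by linarith)]
    have := sin_pos_of_pos_of_lt_pi h (by linarith [Real.pi_gt_three])
    linarith
  · have := sin_ge h3 h2
    linarith [st_le_one (100 * (x - π / 4))]

lemma U_ge {x : ℝ} (h : π / 4 ≤ x) (h2 : x ≤ 2) : 707 / 1000 < U x := by
  unfold U
  have := T_nonneg (100 * (x - π / 4))
  linarith [sin_ge h h2]

lemma gap_left : 1 / 1000 < √(π / 4) - U (π / 4) := by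
  rw [U_eq le_rfl, sin_pi_div_four]
  have h1 : (0.88 : ℝ) < √(π / 4) :=
    Real.lt_sqrt_of_sq_lt (by norm_num; linarith [Real.pi_gt_d4])
  have h2 : √2 < (1.42 : ℝ) := (Real.sqrt_lt' (by norm_num)).2 (by norm_num)
  linarith

lemma gap_right : √2 - U 2 < - (1 / 1000) := by
  have h2 : √2 < (1.4143 : ℝ) := (Real.sqrt_lt' (by norm_num)).2 (by norm_num)
  have hp := Real.pi_gt_d4
  have hp' := Real.pi_lt_d4
  have h3 : (0.907 : ℝ) < sin 2 := by
    rw [← cos_sub_pi_div_two]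
    have := one_sub_sq_div_two_le_cos (x := 2 - π / 2)
    nlinarith
  have h4 := T_ge (x := 100 * (2 - π / 4)) (by linarith)
  have h5 : (120.45 : ℝ) ≤ 100 * (2 - π / 4) - 1 := by linarith
  have h6 : (120.45 : ℝ) ^ 2 ≤ (100 * (2 - π / 4) - 1) ^ 2 := by gcongr
  unfold U
  norm_num at h6
  linarith

noncomputable def dV (x : ℝ) : ℝ := 1 / (2 * √x)
noncomputable def ddV (x : ℝ) : ℝ := -(2 * (1 / (2 * √x))) / (2 * √x) ^ 2
lemma V_deriv {x : ℝ} (h : 0 < x) : HasDerivAt Real.sqrt (dV x) x := Real.hasDerivAt_sqrt h.ne'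
lemma dV_deriv {x : ℝ} (h : 0 < x) : HasDerivAt dV (ddV x) x := by
  have h0 : 2 * √x ≠ 0 := by positivity
  have := ((Real.hasDerivAt_sqrt h.ne').const_mul 2).fun_inv h0
  have e : dV = fun x => (2 * √x)⁻¹ := by funext x; simp only [dV, one_div]
  rw [e]; exact this
lemma ddV_neg {x : ℝ} (h : 0 < x) : ddV x < 0 := by
  unfold ddV
  have : 0 < √x := Real.sqrt_pos.2 h
  rw [neg_div]
  exact neg_neg_of_pos (by positivity)

/-- smoothed positive part -/
noncomputable def P (d : ℝ) : ℝ := 1 / 500 * S (500 * (d + 1 / 1000))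
lemma P_smooth : ContDiff ℝ (⊤ : ℕ∞) P := by
  have h : ContDiff ℝ (⊤ : ℕ∞) (fun x => S (500 * (x + 1 / 1000))) := S_smooth.comp (by fun_prop)
  unfold P
  exact contDiff_const.mul h
lemma lin_deriv2 (x : ℝ) : HasDerivAt (fun x : ℝ => 500 * (x + 1 / 1000)) 500 x := by
  exact (((hasDerivAt_id x).add_const (1 / 1000)).const_mul 500).congr_deriv (by norm_num)
noncomputable def dP (d : ℝ) : ℝ := st (500 * (d + 1 / 1000))
lemma P_deriv (x : ℝ) : HasDerivAt P (dP x) x := by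
  have := ((S_hasDeriv (500 * (x + 1 / 1000))).comp x (lin_deriv2 x)).const_mul (1 / 500)
  refine this.congr_deriv ?_
  unfold dP; ring
lemma dP_deriv (x : ℝ) : HasDerivAt dP (deriv st (500 * (x + 1 / 1000)) * 500) x :=
  (st_hasDeriv (500 * (x + 1 / 1000))).comp x (lin_deriv2 x)
lemma P_left {d : ℝ} (h : d ≤ - (1 / 1000)) : P d = 0 := by
  unfold P; rw [S_zero (by linarith)]; simp
lemma P_right {d : ℝ} (h : 1 / 1000 ≤ d) : P d = d := by
  unfold P; rw [S_ge_one (by linarith)]; ring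
lemma P_le {d : ℝ} (h : - (1 / 1000) ≤ d) : P d ≤ d + 1 / 1000 := by
  unfold P; have := S_le (x := 500 * (d + 1 / 1000)) (by linarith); linarith

noncomputable def M (x : ℝ) : ℝ := √x - P (√x - U x)
noncomputable def dM (x : ℝ) : ℝ := dV x - dP (√x - U x) * (dV x - dU x)
noncomputable def ddM (x : ℝ) : ℝ := ddV x -
  ((deriv st (500 * (√x - U x + 1 / 1000)) * 500 * (dV x - dU x)) * (dV x - dU x)
    + dP (√x - U x) * (ddV x - ddU x))

lemma M_deriv {x : ℝ} (h : 0 < x) : HasDerivAt M (dM x) x :=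
  (V_deriv h).sub ((P_deriv _).comp x ((V_deriv h).sub (U_deriv x)))
lemma dM_deriv {x : ℝ} (h : 0 < x) : HasDerivAt dM (ddM x) x := by
  have hg : HasDerivAt (fun x => √x - U x) (dV x - dU x) x := (V_deriv h).sub (U_deriv x)
  have hg' : HasDerivAt (fun x => dV x - dU x) (ddV x - ddU x) x := (dV_deriv h).sub (dU_deriv x)
  have hp : HasDerivAt (fun x => dP (√x - U x))
      (deriv st (500 * (√x - U x + 1 / 1000)) * 500 * (dV x - dU x)) x :=
    HasDerivAt.comp (h₂ := dP) x (dP_deriv (√x - U x)) hg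
  exact (dV_deriv h).sub (hp.mul hg')
lemma ddM_neg {x : ℝ} (h : 0 < x) (h2 : x ≤ 2) : ddM x < 0 := by
  have h1 := ddU_neg h h2
  have h3 := ddV_neg h
  unfold ddM
  have h4 : 0 ≤ dP (√x - U x) := st_nonneg _
  have h5 : dP (√x - U x) ≤ 1 := st_le_one _
  have h6 := st_deriv_nonneg (500 * (√x - U x + 1 / 1000))
  generalize dP (√x - U x) = p at *
  generalize deriv st (500 * (√x - U x + 1 / 1000)) = q at *
  have h7 := mul_nonneg h6 (sq_nonneg (dV x - dU x))
  rcases h4.eq_or_lt with h8 | h8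
  · subst h8; nlinarith
  · nlinarith [mul_pos h8 (neg_pos.2 h1), mul_nonneg (sub_nonneg.2 h5) (neg_pos.2 h3).le]
lemma M_pos {x : ℝ} (h : π / 4 ≤ x) (h2 : x ≤ 2) : 0 < M x := by
  unfold M
  have h0 : 0 < x := lt_of_lt_of_le (by positivity) h
  rcases le_total (√x - U x) (- (1 / 1000)) with h3 | h3
  · rw [P_left h3]; simpa using h0
  · have := P_le h3
    linarith [U_ge h h2]
lemma M_smooth {x : ℝ} (h : 0 < x) : ContDiffAt ℝ (⊤ : ℕ∞) M x := by
  have hs : ContDiffAt ℝ (⊤ : ℕ∞) Real.sqrt x := Real.contDiffAt_sqrt h.ne'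
  exact hs.sub (P_smooth.contDiffAt.comp x (hs.sub U_smooth.contDiffAt))

open Classical in
noncomputable def f (x : ℝ) : ℝ := if x ≤ π / 4 then sin x else if x < 2 then M x else √x

lemma pi4_lt : π / 4 < 2 := by linarith [Real.pi_lt_four]

lemma f_left {x : ℝ} (h : x ≤ π / 4) : f x = sin x := by simp [f, h]
lemma f_right {x : ℝ} (h : 2 ≤ x) : f x = √x := by
  simp [f, not_le.2 (pi4_lt.trans_le h), not_lt.2 h]
lemma f_mid {x : ℝ} (h : π / 4 < x) (h2 : x < 2) : f x = M x := by
  simp [f, not_le.2 h, h2]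

lemma gap_cont : Continuous fun x => √x - U x :=
  Real.continuous_sqrt.sub U_smooth.continuous

lemma ev_left {r : ℝ} (h : r ≤ π / 4) : f =ᶠ[𝓝 r] U := by
  rcases h.lt_or_eq with h | rfl
  · filter_upwards [Iio_mem_nhds h] with x hx
    rw [f_left (le_of_lt hx), U_eq (le_of_lt hx)]
  · filter_upwards [gap_cont.continuousAt.eventually (lt_mem_nhds gap_left),
      Iio_mem_nhds pi4_lt] with x hx hx2
    rcases le_or_gt x (π / 4) with h | h
    · rw [f_left h, U_eq h]
    · rw [f_mid h hx2, M, P_right (le_of_lt hx)]; ring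

lemma ev_mid {r : ℝ} (h : π / 4 < r) (h2 : r < 2) : f =ᶠ[𝓝 r] M := by
  filter_upwards [Ioo_mem_nhds h h2] with x hx
  exact f_mid hx.1 hx.2

lemma ev_right {r : ℝ} (h : 2 ≤ r) : f =ᶠ[𝓝 r] Real.sqrt := by
  rcases h.lt_or_eq with h | rfl
  · filter_upwards [Ioi_mem_nhds h] with x hx
    exact f_right (le_of_lt hx)
  · filter_upwards [gap_cont.continuousAt.eventually (gt_mem_nhds gap_right),
      Ioi_mem_nhds pi4_lt] with x hx hx2
    rcases le_or_gt 2 x with h | h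
    · exact f_right h
    · rw [f_mid hx2 h, M, P_left (le_of_lt hx)]; ring

lemma f_smooth : ContDiff ℝ (⊤ : ℕ∞) f := by
  rw [contDiff_iff_contDiffAt]
  intro r
  have hpi := Real.pi_pos
  rcases le_or_gt r (π / 4) with h | h
  · exact U_smooth.contDiffAt.congr_of_eventuallyEq (ev_left h)
  · rcases lt_or_ge r 2 with h2 | h2
    · exact (M_smooth (by linarith)).congr_of_eventuallyEq (ev_mid h h2)
    · exact (Real.contDiffAt_sqrt (by linarith)).congr_of_eventuallyEq (ev_right h2)

lemma dd {g g' : ℝ → ℝ} {g'' r : ℝ} (h : f =ᶠ[𝓝 r] g) (h1 : ∀ᶠ x in 𝓝 r, HasDerivAt g (g' x) x)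
    (h2 : HasDerivAt g' g'' r) : deriv (deriv f) r = g'' := by
  have e : deriv f =ᶠ[𝓝 r] g' := h.deriv.trans (h1.mono fun x hx => hx.deriv)
  rw [e.deriv_eq, h2.deriv]

lemma f_dd {r : ℝ} (h0 : 0 < r) : deriv (deriv f) r < 0 := by
  rcases le_or_gt r (π / 4) with h | h
  · rw [dd (ev_left h) (Eventually.of_forall U_deriv) (dU_deriv r)]
    exact ddU_neg h0 (h.trans pi4_lt.le)
  · rcases lt_or_ge r 2 with h2 | h2
    · rw [dd (ev_mid h h2) ((lt_mem_nhds h0).mono fun x hx => M_deriv hx) (dM_deriv h0)]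
      exact ddM_neg h0 h2.le
    · rw [dd (ev_right h2) ((lt_mem_nhds h0).mono fun x hx => V_deriv hx) (dV_deriv h0)]
      exact ddV_neg h0

lemma f_pos {r : ℝ} (h0 : 0 < r) : 0 < f r := by
  rcases le_or_gt r (π / 4) with h | h
  · rw [f_left h]; exact sin_pos_of_pos_of_lt_pi h0 (by linarith)
  · rcases lt_or_ge r 2 with h2 | h2
    · rw [f_mid h h2]; exact M_pos h.le h2.le
    · rw [f_right h2]; exact Real.sqrt_pos.2 h0

lemma ev_zero : f =ᶠ[𝓝 0] sin := by
  filter_upwards [Iio_mem_nhds (show (0:ℝ) < π / 4 by positivity)] with x hx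
  exact f_left (le_of_lt hx)

lemma f_concave : ConcaveOn ℝ (Ioo (π / 4) 2) f := by
  have hd : Differentiable ℝ f := f_smooth.differentiable (by simp)
  have hd' : Differentiable ℝ (deriv f) :=
    ((contDiff_infty_iff_deriv.1 f_smooth).2).differentiable (by simp)
  refine concaveOn_of_deriv2_nonpos (convex_Ioo _ _) hd.continuous.continuousOn
    hd.differentiableOn hd'.differentiableOn ?_
  intro x hx
  rw [interior_Ioo] at hx
  exact (f_dd (lt_trans (by positivity) hx.1)).le

end Interp



/-- The interpolation lemma: there is a smooth function `f` with `f = sin` near `0`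
(so `f 0 = 0`, `f' 0 = 1` and all even derivatives of `f` vanish at `0`),
`f r = √r` for `r ≥ 2`, `f` positive on `(0,∞)`, `f` concave on `(π/4, 2)`, and
`-f''/f > 0` everywhere on `(0,∞)`. Such an `f` gives a complete rotationally
symmetric metric `dr² + f(r)² dθ²` on `ℝ²` of positive curvature with quadratic
decay. -/
theorem stmt_7 :
    ∃ f : ℝ → ℝ, ContDiff ℝ (⊤ : ℕ∞) f ∧
      f 0 = 0 ∧
      (∀ r : ℝ, r ≤ π / 4 → f r = Real.sin r) ∧
      (∀ r : ℝ, 2 ≤ r → f r = Real.sqrt r) ∧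
      (∀ r : ℝ, 0 < r → 0 < f r) ∧
      ConcaveOn ℝ (Set.Ioo (π / 4) 2) f ∧
      deriv f 0 = 1 ∧
      (∀ k : ℕ, iteratedDeriv (2 * k) f 0 = 0) ∧
      (∀ r : ℝ, 0 < r → 0 < -(deriv (deriv f) r) / f r) := by
  refine ⟨Interp.f, Interp.f_smooth, ?_, fun r h => Interp.f_left h, fun r h => Interp.f_right h,
    fun r h => Interp.f_pos h, Interp.f_concave, ?_, ?_, fun r h => ?_⟩
  · rw [Interp.ev_zero.eq_of_nhds, sin_zero]
  · rw [Interp.ev_zero.deriv_eq]; simp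
  · intro k
    rw [Interp.ev_zero.iteratedDeriv_eq]
    simp [Real.iteratedDeriv_even_sin]
  · exact div_pos (neg_pos.2 (Interp.f_dd h)) (Interp.f_pos h)
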